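/- Let H : ℝⁿ ⇉ ℝⁿ be a convex process such that dom(H) + R₋ = ℝⁿ, R₊ = ℝⁿ, and im(H) + N₋ = ℝⁿ. Then H is null-controllable if and only if the negative dual process H⁻ has no positive eigenvalues. -/

import Mathlib

open Pointwise Set RealInnerProductSpace

namespace ConvexProcessPaper

/-- A convex cone: a nonempty convex set closed under nonnegative scalar multiplication. -/
def IsConvexCone {V : Type*} [AddCommMonoid V] [Module ℝ V] (S : Set V) : Prop :=
  S.Nonempty ∧ Convex ℝ S ∧ ∀ c : ℝ, 0 ≤ c → ∀ x ∈ S, c • x ∈ S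

/-- A set is a linear subspace. -/
def IsLinearSubspace {V : Type*} [AddCommGroup V] [Module ℝ V] (S : Set V) : Prop :=
  ∃ W : Submodule ℝ V, (W : Set V) = S

/-- Set-valued maps from ℝⁿ to ℝⁿ. -/
abbrev SVMap (n : ℕ) := EuclideanSpace ℝ (Fin n) → Set (EuclideanSpace ℝ (Fin n))

variable {n : ℕ}

/-- The graph of a set-valued map. -/
def graph (H : SVMap n) : Set (EuclideanSpace ℝ (Fin n) × EuclideanSpace ℝ (Fin n)) :=
  {p | p.2 ∈ H p.1}

/-- A convex process: a set-valued map whose graph is a convex cone. -/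
def IsConvexProcess (H : SVMap n) : Prop := IsConvexCone (graph H)

/-- The domain of a set-valued map. -/
def dom (H : SVMap n) : Set (EuclideanSpace ℝ (Fin n)) := {x | (H x).Nonempty}

/-- The image of a set-valued map. -/
def im (H : SVMap n) : Set (EuclideanSpace ℝ (Fin n)) := {y | ∃ x, y ∈ H x}

/-- The inverse of a set-valued map: gr(H⁻¹) = {(y,x) : (x,y) ∈ gr(H)}. -/
def invMap (H : SVMap n) : SVMap n := fun y => {x | y ∈ H x}

/-- The image of a set under a set-valued map: H(S) = ⋃_{x ∈ S} H(x). -/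
def imSet (H : SVMap n) (S : Set (EuclideanSpace ℝ (Fin n))) :
    Set (EuclideanSpace ℝ (Fin n)) := ⋃ x ∈ S, H x

/-- The reachable set: R(H) = ⋃_{ℓ ≥ 0} H^ℓ({0}). -/
def reach (H : SVMap n) : Set (EuclideanSpace ℝ (Fin n)) := ⋃ ℓ : ℕ, (imSet H)^[ℓ] {0}

/-- The null-controllable set: N(H) = R(H⁻¹). -/
def nullc (H : SVMap n) : Set (EuclideanSpace ℝ (Fin n)) := reach (invMap H)

/-- The feasible set: states from which an infinite trajectory emanates. -/
def feas (H : SVMap n) : Set (EuclideanSpace ℝ (Fin n)) :=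
  {ξ | ∃ x : ℕ → EuclideanSpace ℝ (Fin n), x 0 = ξ ∧ ∀ k, x (k + 1) ∈ H (x k)}

/-- The minimal linear process L₋: gr(L₋) = lin(gr(H)) = gr(H) ∩ (−gr(H)). -/
def Lminus (H : SVMap n) : SVMap n := fun x => {y | y ∈ H x ∧ -y ∈ H (-x)}

/-- The maximal linear process L₊: gr(L₊) = Lin(gr(H)) = gr(H) − gr(H). -/
def Lplus (H : SVMap n) : SVMap n :=
  fun x => {y | ∃ x₁ y₁ x₂ y₂, y₁ ∈ H x₁ ∧ y₂ ∈ H x₂ ∧ x = x₁ - x₂ ∧ y = y₁ - y₂}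

/-- The negative dual process: p ∈ H⁻(q) ⇔ ⟨p,x⟩ ≥ ⟨q,y⟩ for all (x,y) ∈ gr(H). -/
def negDual (H : SVMap n) : SVMap n :=
  fun q => {p | ∀ x y, y ∈ H x → ⟪q, y⟫ ≤ ⟪p, x⟫}

/-- The positive dual process: p ∈ H⁺(q) ⇔ ⟨p,x⟩ ≤ ⟨q,y⟩ for all (x,y) ∈ gr(H). -/
def posDual (H : SVMap n) : SVMap n :=
  fun q => {p | ∀ x y, y ∈ H x → ⟪p, x⟫ ≤ ⟪q, y⟫}

/-- The negative polar cone of a set. -/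
def negPolar (C : Set (EuclideanSpace ℝ (Fin n))) : Set (EuclideanSpace ℝ (Fin n)) :=
  {y | ∀ x ∈ C, ⟪x, y⟫ ≤ 0}

/-- The positive polar cone of a set. -/
def posPolar (C : Set (EuclideanSpace ℝ (Fin n))) : Set (EuclideanSpace ℝ (Fin n)) :=
  {y | ∀ x ∈ C, 0 ≤ ⟪x, y⟫}

/-- C is weakly H invariant: H(x) ∩ C ≠ ∅ for all x ∈ C. -/
def WeaklyInv (H : SVMap n) (C : Set (EuclideanSpace ℝ (Fin n))) : Prop :=
  ∀ x ∈ C, (H x ∩ C).Nonempty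

/-- C is strongly H invariant: H(x) ⊆ C for all x ∈ C. -/
def StronglyInv (H : SVMap n) (C : Set (EuclideanSpace ℝ (Fin n))) : Prop :=
  ∀ x ∈ C, H x ⊆ C

/-- H is reachable: every feasible state is reachable. -/
def IsReachable (H : SVMap n) : Prop := feas H ⊆ reach H

/-- H is null-controllable: every feasible state is null-controllable. -/
def IsNullControllable (H : SVMap n) : Prop := feas H ⊆ nullc H

section Compactness

variable {V W : Type*} [NormedAddCommGroup V] [NormedSpace ℝ V] [FiniteDimensional ℝ V]
  [NormedAddCommGroup W] [NormedSpace ℝ W]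

/-- A continuous linear map with no nonzero zero on a closed cone is bounded below on it. -/
theorem exists_pos_mul_norm_le_of_isClosed (T : PointedCone ℝ V) (hT : IsClosed (T : Set V))
    (f : V →L[ℝ] W) (hf : ∀ z ∈ T, f z = 0 → z = 0) :
    ∃ ε > 0, ∀ z ∈ T, ε * ‖z‖ ≤ ‖f z‖ := by
  have hcpt : IsCompact ((T : Set V) ∩ Metric.sphere 0 1) :=
    (isCompact_sphere (0 : V) 1).inter_left hT
  obtain ⟨ε, hε, hle⟩ : ∃ ε > 0, ∀ z ∈ (T : Set V) ∩ Metric.sphere 0 1, ε ≤ ‖f z‖ := by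
    rcases ((T : Set V) ∩ Metric.sphere 0 1).eq_empty_or_nonempty with h | h
    · exact ⟨1, one_pos, by simp [h]⟩
    · obtain ⟨w, hw, hmin⟩ := hcpt.exists_isMinOn h (f.continuous.norm.continuousOn)
      refine ⟨‖f w‖, norm_pos_iff.2 fun h0 => ?_, fun z hz => hmin hz⟩
      have := hf w hw.1 h0
      have h1 := hw.2
      simp [this] at h1
  refine ⟨ε, hε, fun z hz => ?_⟩
  rcases eq_or_ne z 0 with rfl | hz0
  · simp
  have hn : 0 < ‖z‖ := norm_pos_iff.2 hz0
  have hmem : (‖z‖⁻¹ • z) ∈ (T : Set V) ∩ Metric.sphere 0 1 := by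
    refine ⟨T.smul_mem (by positivity) hz, ?_⟩
    simp [norm_smul, hn.ne']
  have := hle _ hmem
  rw [map_smul, norm_smul, norm_inv, norm_norm] at this
  rw [inv_mul_eq_div, le_div_iff₀ hn] at this
  exact this

end Compactness

/-- A positive sequence bounded away from zero that controls its own partial sums grows
geometrically. -/
theorem exists_geometric_le {b : ℕ → ℝ} {κ c : ℝ} {K : ℕ} (hb : ∀ k, 0 < b k) (hκ : 0 < κ)
    (hc : 0 < c) (hcb : ∀ k ≥ K, c ≤ b k)
    (hsum : ∀ m, κ * ∑ k ∈ Finset.range m, b k ≤ b m + b 0) :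
    ∃ d > 0, ∃ M : ℕ, ∀ m ≥ M, d * (1 + κ / 2) ^ m ≤ b m := by
  have hns : ¬ Summable b := fun h => by
    have h0 := h.tendsto_atTop_zero
    have := ge_of_tendsto h0 (Filter.eventually_atTop.2 ⟨K, hcb⟩)
    linarith
  have ht := (not_summable_iff_tendsto_nat_atTop_of_nonneg fun k => (hb k).le).1 hns
  obtain ⟨M, hM⟩ := Filter.eventually_atTop.1 (ht.eventually_ge_atTop (2 * b 0 / κ))
  set A : ℕ → ℝ := fun m => ∑ k ∈ Finset.range m, b k with hA
  have hhalf : ∀ m ≥ M, κ / 2 * A m ≤ b m := fun m hm => by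
    have h1 := hM m hm
    rw [div_le_iff₀ hκ] at h1
    have h2 := hsum m
    simp only [hA]
    linarith
  have hAM : 0 < A M := lt_of_lt_of_le (by have := hb 0; positivity) (hM M le_rfl)
  have hgrow : ∀ j, A M * (1 + κ / 2) ^ j ≤ A (M + j) := fun j => by
    induction j with
    | zero => simp
    | succ j ih =>
      have h1 : A (M + (j + 1)) = A (M + j) + b (M + j) := by
        simp only [hA]
        rw [← add_assoc, Finset.sum_range_succ]
      have h2 := hhalf (M + j) (by omega)
      rw [h1, pow_succ]
      nlinarith
  refine ⟨κ / 2 * A M / (1 + κ / 2) ^ M, by positivity, M, fun m hm => ?_⟩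
  obtain ⟨j, rfl⟩ := Nat.exists_eq_add_of_le hm
  refine le_trans ?_ (hhalf _ hm)
  rw [pow_add]
  have : κ / 2 * A M / (1 + κ / 2) ^ M * ((1 + κ / 2) ^ M * (1 + κ / 2) ^ j)
      = κ / 2 * (A M * (1 + κ / 2) ^ j) := by
    field_simp
  rw [this]
  have := hgrow j
  gcongr

section Eigenvector

variable {E : Type*} [NormedAddCommGroup E] [InnerProductSpace ℝ E] [FiniteDimensional ℝ E]

/-- A closed conic relation with an infinite nonzero trajectory inside a pointed cone has an
eigenvector with positive eigenvalue. -/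
theorem exists_eigenvector_of_trajectory (T : PointedCone ℝ (E × E))
    (hT : IsClosed (T : Set (E × E))) (hfst : ∀ p, (0, p) ∈ T → p = 0)
    (hsnd : ∀ q, (q, 0) ∈ T → q = 0) (q : ℕ → E) (hq : ∀ k, (q k, q (k + 1)) ∈ T)
    (hq0 : q 0 ≠ 0) (e : E) (δ : ℝ) (hδ : 0 < δ) (he : ∀ k, δ * ‖q k‖ ≤ ⟪e, q k⟫) :
    ∃ s : ℝ, 0 < s ∧ ∃ ξ ≠ 0, (ξ, s • ξ) ∈ T := by
  have hqne : ∀ k, q k ≠ 0 := fun k => by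
    induction k with
    | zero => exact hq0
    | succ k ih => exact fun h => ih (hsnd _ (h ▸ hq k))
  set a : ℕ → ℝ := fun k => ⟪e, q k⟫ with ha
  have hapos : ∀ k, 0 < a k := fun k =>
    lt_of_lt_of_le (mul_pos hδ (norm_pos_iff.2 (hqne k))) (he k)
  have hale : ∀ k, a k ≤ ‖e‖ * ‖q k‖ := fun k => real_inner_le_norm _ _
  have hepos : 0 < ‖e‖ := by
    refine norm_pos_iff.2 fun h => ?_
    have := hapos 0
    simp [ha, h] at this
  obtain ⟨ε₁, hε₁, hb₁⟩ := exists_pos_mul_norm_le_of_isClosed T hT (ContinuousLinearMap.fst ℝ E E)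
    (by
      rintro ⟨x, y⟩ hz h
      obtain rfl : x = 0 := h
      rw [hfst y hz]; rfl)
  obtain ⟨ε₂, hε₂, hb₂⟩ := exists_pos_mul_norm_le_of_isClosed T hT (ContinuousLinearMap.snd ℝ E E)
    (by
      rintro ⟨x, y⟩ hz h
      obtain rfl : y = 0 := h
      rw [hsnd x hz]; rfl)
  have hup : ∀ k, a (k + 1) ≤ ‖e‖ / (ε₁ * δ) * a k := fun k => by
    have h1 := (mul_le_mul_of_nonneg_left (norm_snd_le (q k, q (k + 1))) hε₁.le).trans
      (hb₁ _ (hq k))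
    have h2 := he k
    have h3 := hale (k + 1)
    rw [div_mul_eq_mul_div, le_div_iff₀ (by positivity)]
    simp only [ContinuousLinearMap.coe_fst'] at h1
    calc a (k + 1) * (ε₁ * δ) ≤ ‖e‖ * ‖q (k + 1)‖ * (ε₁ * δ) := by gcongr
      _ = ‖e‖ * (δ * (ε₁ * ‖q (k + 1)‖)) := by ring
      _ ≤ ‖e‖ * (δ * ‖q k‖) := by gcongr
      _ ≤ ‖e‖ * a k := by gcongr
  have hlow : ∀ k, ε₂ * δ / ‖e‖ * a k ≤ a (k + 1) := fun k => by
    have h1 := (mul_le_mul_of_nonneg_left (norm_fst_le (q k, q (k + 1))) hε₂.le).trans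
      (hb₂ _ (hq k))
    have h2 := he (k + 1)
    have h3 := hale k
    rw [div_mul_eq_mul_div, div_le_iff₀ hepos]
    simp only [ContinuousLinearMap.coe_snd'] at h1
    calc ε₂ * δ * a k ≤ ε₂ * δ * (‖e‖ * ‖q k‖) := by gcongr
      _ = ‖e‖ * (δ * (ε₂ * ‖q k‖)) := by ring
      _ ≤ ‖e‖ * (δ * ‖q (k + 1)‖) := by gcongr
      _ ≤ ‖e‖ * a (k + 1) := by gcongr
      _ = a (k + 1) * ‖e‖ := mul_comm _ _
  set c₁ := ε₂ * δ / ‖e‖ with hc₁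
  set c₂ := ‖e‖ / (ε₁ * δ) with hc₂
  have hc₁pos : 0 < c₁ := by positivity
  have hc₂pos : 0 < c₂ := by positivity
  set P : Set ℝ := {s | 0 < s ∧ ∃ c > 0, ∃ K : ℕ, ∀ k ≥ K, c * s ^ k ≤ a k} with hP
  have hc₁P : c₁ ∈ P := by
    refine ⟨hc₁pos, a 0, hapos 0, 0, fun k _ => ?_⟩
    induction k with
    | zero => simp
    | succ k ih =>
      calc a 0 * c₁ ^ (k + 1) = c₁ * (a 0 * c₁ ^ k) := by ring
        _ ≤ c₁ * a k := by gcongr; exact ih (Nat.zero_le _)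
        _ ≤ a (k + 1) := hlow k
  have hupP : ∀ k, a k ≤ a 0 * c₂ ^ k := fun k => by
    induction k with
    | zero => simp
    | succ k ih =>
      calc a (k + 1) ≤ c₂ * a k := hup k
        _ ≤ c₂ * (a 0 * c₂ ^ k) := by gcongr
        _ = a 0 * c₂ ^ (k + 1) := by ring
  have hbdd : BddAbove P := by
    refine ⟨c₂, fun s hs => ?_⟩
    obtain ⟨hs, c, hc, K, hK⟩ := hs
    by_contra! hlt
    have hr : 1 < s / c₂ := (one_lt_div hc₂pos).2 hlt
    obtain ⟨k, hk, hkK⟩ := ((tendsto_pow_atTop_atTop_of_one_lt hr).eventually_gt_atTop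
      (a 0 / c) |>.and (Filter.eventually_ge_atTop K)).exists
    have h1 := (hK k hkK).trans (hupP k)
    rw [div_pow, lt_div_iff₀ (by positivity), div_mul_eq_mul_div, div_lt_iff₀ hc] at hk
    linarith
  set s₀ := sSup P with hs₀
  have hs₀pos : 0 < s₀ := hc₁pos.trans_le (le_csSup hbdd hc₁P)
  by_contra! hno
  obtain ⟨ε, hε, hb⟩ := exists_pos_mul_norm_le_of_isClosed T hT
    (ContinuousLinearMap.snd ℝ E E - s₀ • ContinuousLinearMap.fst ℝ E E)
    (by
      rintro ⟨x, y⟩ hz h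
      have h' : y = s₀ • x := sub_eq_zero.1 h
      subst h'
      by_contra hne
      exact hno s₀ hs₀pos x (fun h0 => hne (by simp [h0])) hz)
  set κ := δ * ε / (2 * s₀ * ‖e‖) with hκ
  have hκpos : 0 < κ := by positivity
  obtain ⟨s, hsP, hslt⟩ := exists_lt_of_lt_csSup ⟨c₁, hc₁P⟩
    (show max (s₀ - ε / 2) (s₀ / (1 + κ / 2)) < s₀ from
      max_lt (by linarith) (div_lt_self hs₀pos (by linarith)))
  have hsle : s ≤ s₀ := le_csSup hbdd hsP
  obtain ⟨hspos, c, hc, K, hK⟩ := hsP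
  have hs1 := (le_max_left _ _).trans_lt hslt
  have hs2 := (le_max_right _ _).trans_lt hslt
  set B : ℕ → E := fun m => ∑ k ∈ Finset.range m, (s⁻¹) ^ k • q k with hB
  have hBT : ∀ m, (B m, s • (B m + ((s⁻¹) ^ m • q m - q 0))) ∈ T := fun m => by
    have hmem : ∑ k ∈ Finset.range m, (s⁻¹) ^ k • (q k, q (k + 1)) ∈ T :=
      T.sum_mem fun k _ =>
        T.smul_mem (by positivity) (hq k)
    convert hmem using 1
    induction m with
    | zero => simp [hB]
    | succ m ih =>
      have hBs : B (m + 1) = B m + (s⁻¹) ^ m • q m := by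
        simp only [hB]; rw [Finset.sum_range_succ]
      rw [Finset.sum_range_succ, ← ih (T.sum_mem fun k _ =>
        T.smul_mem (by positivity) (hq k)), hBs]
      refine Prod.ext rfl ?_
      have : s • (s⁻¹) ^ (m + 1) • q (m + 1) = (s⁻¹) ^ m • q (m + 1) := by
        rw [smul_smul, pow_succ']
        congr 1
        field_simp
      simp only [Prod.smul_mk, Prod.mk_add_mk]
      rw [← this]
      module
  have hmain : ∀ m, κ * ∑ k ∈ Finset.range m, (s⁻¹) ^ k * a k ≤ (s⁻¹) ^ m * a m + (s⁻¹) ^ 0 * a 0 :=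
    fun m => by
    have hsumA : ∑ k ∈ Finset.range m, (s⁻¹) ^ k * a k = ⟪e, B m⟫ := by
      simp only [hB, ha, inner_sum, inner_smul_right]
    set u := (s⁻¹) ^ m • q m - q 0 with hu
    have h1 : ε * ‖B m‖ ≤ ‖s • (B m + u) - s₀ • B m‖ :=
      (mul_le_mul_of_nonneg_left (norm_fst_le _) hε.le).trans (hb _ (hBT m))
    have h2 : ‖s • (B m + u) - s₀ • B m‖ ≤ (s₀ - s) * ‖B m‖ + s * ‖u‖ := by
      have : s • (B m + u) - s₀ • B m = s • u - (s₀ - s) • B m := by module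
      rw [this]
      refine (norm_sub_le _ _).trans ?_
      rw [norm_smul, norm_smul, Real.norm_of_nonneg hspos.le,
        Real.norm_of_nonneg (sub_nonneg.2 hsle)]
      linarith
    have h3 : ε / 2 * ‖B m‖ ≤ s₀ * ‖u‖ := by
      have : (s₀ - s) * ‖B m‖ ≤ ε / 2 * ‖B m‖ := by gcongr; linarith
      have : s * ‖u‖ ≤ s₀ * ‖u‖ := by gcongr
      linarith
    have h4 : δ * ‖u‖ ≤ (s⁻¹) ^ m * a m + (s⁻¹) ^ 0 * a 0 := by
      have h5 : ‖u‖ ≤ (s⁻¹) ^ m * ‖q m‖ + ‖q 0‖ := by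
        refine (norm_sub_le _ _).trans ?_
        rw [norm_smul, Real.norm_of_nonneg (by positivity)]
      calc δ * ‖u‖ ≤ δ * ((s⁻¹) ^ m * ‖q m‖ + ‖q 0‖) := by gcongr
        _ = (s⁻¹) ^ m * (δ * ‖q m‖) + (s⁻¹) ^ 0 * (δ * ‖q 0‖) := by ring
        _ ≤ _ := by gcongr; exacts [he m, he 0]
    rw [hsumA]
    refine le_trans ?_ h4
    rw [hκ, div_mul_eq_mul_div, div_le_iff₀ (by positivity)]
    calc δ * ε * ⟪e, B m⟫ ≤ δ * ε * (‖e‖ * ‖B m‖) := by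
          gcongr; exact real_inner_le_norm _ _
      _ = 2 * ‖e‖ * δ * (ε / 2 * ‖B m‖) := by ring
      _ ≤ 2 * ‖e‖ * δ * (s₀ * ‖u‖) := by gcongr
      _ = δ * ‖u‖ * (2 * s₀ * ‖e‖) := by ring
  obtain ⟨d, hd, M, hM⟩ := exists_geometric_le (b := fun k => (s⁻¹) ^ k * a k) (K := K)
    (fun k => mul_pos (by positivity) (hapos k)) hκpos hc
    (fun k hk => by
      have := hK k hk
      rw [inv_pow, inv_mul_eq_div, le_div_iff₀ (by positivity)]
      exact this) hmain
  have hmem : s * (1 + κ / 2) ∈ P := by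
    refine ⟨by positivity, d, hd, M, fun m hm => ?_⟩
    have := hM m hm
    rw [inv_pow, inv_mul_eq_div, le_div_iff₀ (by positivity)] at this
    rw [mul_pow]
    linarith
  have := le_csSup hbdd hmem
  rw [div_lt_iff₀ (by positivity)] at hs2
  linarith

/-- A convex cone that no nonzero vector annihilates has nonempty interior. -/
theorem interior_nonempty_of_forall_inner_eq_zero (C : PointedCone ℝ E)
    (h : ∀ q : E, (∀ c ∈ C, ⟪q, c⟫ = 0) → q = 0) : (interior (C : Set E)).Nonempty := by
  have hconv : Convex ℝ (C : Set E) := C.convex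
  rw [hconv.interior_nonempty_iff_affineSpan_eq_top,
    AffineSubspace.affineSpan_eq_top_iff_vectorSpan_eq_top_of_nonempty ℝ E E ⟨0, C.zero_mem⟩,
    ← Submodule.orthogonal_eq_bot_iff, eq_bot_iff]
  intro q hq
  refine h q fun c hc => ?_
  have := hq c (by simpa using vsub_mem_vectorSpan ℝ (s := (C : Set E)) hc C.zero_mem)
  rwa [real_inner_comm] at this

/-- The dual of a proper convex cone in finite dimension is nontrivial. -/
theorem exists_ne_zero_forall_inner_nonneg (C : PointedCone ℝ E) {z : E} (hz : z ∉ C) :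
    ∃ q : E, q ≠ 0 ∧ ∀ c ∈ C, 0 ≤ ⟪q, c⟫ := by
  by_cases h : ∀ q : E, (∀ c ∈ C, ⟪q, c⟫ = 0) → q = 0
  · have hint := interior_nonempty_of_forall_inner_eq_zero C h
    have hconv : Convex ℝ (C : Set E) := C.convex
    obtain ⟨f, hf⟩ := geometric_hahn_banach_open_point hconv.interior isOpen_interior
      (fun hz' => hz (interior_subset hz'))
    have hle : ∀ c ∈ C, f c ≤ f z := fun c hc => by
      have hc' : c ∈ closure (interior (C : Set E)) := by
        rw [hconv.closure_interior_eq_closure_of_nonempty_interior hint]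
        exact subset_closure hc
      exact closure_minimal (fun x hx => (hf x hx).le)
        (isClosed_le f.continuous continuous_const) hc'
    have hnonpos : ∀ c ∈ C, f c ≤ 0 := fun c hc => by
      by_contra! hpos
      have hz0 : 0 ≤ f z := by simpa using hle 0 C.zero_mem
      have := hle _ (C.smul_mem (show 0 ≤ f z / f c + 1 by positivity) hc)
      have h2 : f ((f z / f c + 1) • c) ≤ f z := this
      rw [map_smul, smul_eq_mul, add_mul, div_mul_cancel₀ _ hpos.ne'] at h2
      linarith
    refine ⟨-(InnerProductSpace.toDual ℝ E).symm f, ?_, fun c hc => ?_⟩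
    · intro h0
      obtain ⟨w, hw⟩ := hint
      have := hf w hw
      have hf0 : f = 0 := by simpa using h0
      simp [hf0] at this
    · rw [inner_neg_left, InnerProductSpace.toDual_symm_apply]
      linarith [hnonpos c hc]
  · push Not at h
    obtain ⟨q, hq, hne⟩ := h
    exact ⟨q, hne, fun c hc => (hq c hc).ge⟩

end Eigenvector

section Iterates

theorem IsConvexProcess.zero_mem {H : SVMap n} (hH : IsConvexProcess H) : 0 ∈ H 0 := by
  obtain ⟨⟨p, hp⟩, -, hs⟩ := hH
  simpa [graph] using hs 0 le_rfl p hp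

theorem IsConvexProcess.smul_mem {H : SVMap n} (hH : IsConvexProcess H) {c : ℝ} (hc : 0 ≤ c)
    {x y : EuclideanSpace ℝ (Fin n)} (h : y ∈ H x) : c • y ∈ H (c • x) :=
  hH.2.2 c hc (x, y) h

theorem IsConvexProcess.add_mem {H : SVMap n} (hH : IsConvexProcess H)
    {x y x' y' : EuclideanSpace ℝ (Fin n)} (h : y ∈ H x) (h' : y' ∈ H x') :
    y + y' ∈ H (x + x') := by
  have hmid : (1 / 2 : ℝ) • (x, y) + (1 / 2 : ℝ) • (x', y') ∈ graph H :=
    hH.2.1 h h' (by norm_num) (by norm_num) (by norm_num)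
  have := hH.2.2 2 (by norm_num) _ hmid
  simpa [graph, smul_add, smul_smul] using this

theorem IsConvexProcess.of_add_smul {H : SVMap n} (h0 : 0 ∈ H 0)
    (hadd : ∀ x y x' y', y ∈ H x → y' ∈ H x' → y + y' ∈ H (x + x'))
    (hsmul : ∀ c : ℝ, 0 ≤ c → ∀ x y, y ∈ H x → c • y ∈ H (c • x)) : IsConvexProcess H :=
  ⟨⟨(0, 0), h0⟩, fun _ hp _ hp' a b ha hb _ =>
    hadd _ _ _ _ (hsmul a ha _ _ hp) (hsmul b hb _ _ hp'), fun c hc _ hp => hsmul c hc _ _ hp⟩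

theorem mem_imSet {H : SVMap n} {S : Set (EuclideanSpace ℝ (Fin n))}
    {y : EuclideanSpace ℝ (Fin n)} : y ∈ imSet H S ↔ ∃ x ∈ S, y ∈ H x := by
  simp [imSet]

theorem mem_iterate_succ {H : SVMap n} {S : Set (EuclideanSpace ℝ (Fin n))} {k : ℕ}
    {y : EuclideanSpace ℝ (Fin n)} :
    y ∈ (imSet H)^[k + 1] S ↔ ∃ x ∈ (imSet H)^[k] S, y ∈ H x := by
  rw [Function.iterate_succ_apply', mem_imSet]

theorem mem_iterate_iff {H : SVMap n} {S : Set (EuclideanSpace ℝ (Fin n))} {k : ℕ}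
    {y : EuclideanSpace ℝ (Fin n)} :
    y ∈ (imSet H)^[k] S ↔ ∃ x ∈ S, y ∈ (imSet H)^[k] {x} := by
  induction k generalizing y with
  | zero => simp
  | succ k ih =>
    simp only [mem_iterate_succ]
    constructor
    · rintro ⟨w, hw, hy⟩
      obtain ⟨x, hx, hxw⟩ := ih.1 hw
      exact ⟨x, hx, w, hxw, hy⟩
    · rintro ⟨x, hx, w, hxw, hy⟩
      exact ⟨w, ih.2 ⟨x, hx, hxw⟩, hy⟩

theorem iterate_add_mem {H G K : SVMap n}
    (h : ∀ x y x' y', y ∈ H x → y' ∈ G x' → y + y' ∈ K (x + x')) {k : ℕ}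
    {x y x' y' : EuclideanSpace ℝ (Fin n)} (hy : y ∈ (imSet H)^[k] {x})
    (hy' : y' ∈ (imSet G)^[k] {x'}) : y + y' ∈ (imSet K)^[k] {x + x'} := by
  induction k generalizing y y' with
  | zero => simp_all
  | succ k ih =>
    rw [mem_iterate_succ] at *
    obtain ⟨w, hw, hy⟩ := hy
    obtain ⟨w', hw', hy'⟩ := hy'
    exact ⟨w + w', ih hw hw', h _ _ _ _ hy hy'⟩

theorem iterate_smul_mem {H : SVMap n} {c : ℝ} (h : ∀ x y, y ∈ H x → c • y ∈ H (c • x)) {k : ℕ}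
    {x y : EuclideanSpace ℝ (Fin n)} (hy : y ∈ (imSet H)^[k] {x}) :
    c • y ∈ (imSet H)^[k] {c • x} := by
  induction k generalizing y with
  | zero => simp_all
  | succ k ih =>
    rw [mem_iterate_succ] at *
    obtain ⟨w, hw, hy⟩ := hy
    exact ⟨c • w, ih hw, h _ _ hy⟩

theorem iterate_mono_map {H G : SVMap n} (h : ∀ x, H x ⊆ G x) {k : ℕ}
    {S : Set (EuclideanSpace ℝ (Fin n))} : (imSet H)^[k] S ⊆ (imSet G)^[k] S := by
  induction k with
  | zero => exact subset_rfl
  | succ k ih =>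
    intro y hy
    rw [mem_iterate_succ] at *
    obtain ⟨w, hw, hy⟩ := hy
    exact ⟨w, ih hw, h _ hy⟩

theorem reach_mono {H G : SVMap n} (h : ∀ x, H x ⊆ G x) : reach H ⊆ reach G :=
  iUnion_mono fun _ => iterate_mono_map h

theorem zero_mem_iterate {H : SVMap n} (h0 : 0 ∈ H 0) (k : ℕ) : 0 ∈ (imSet H)^[k] {0} := by
  induction k with
  | zero => simp
  | succ k ih => exact mem_iterate_succ.2 ⟨0, ih, h0⟩

theorem iterate_le_iterate_add {H : SVMap n} (h0 : 0 ∈ H 0) (k m : ℕ) :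
    (imSet H)^[k] {0} ⊆ (imSet H)^[k + m] {0} := fun y hy => by
  rw [Function.iterate_add_apply]
  exact mem_iterate_iff.2 ⟨0, zero_mem_iterate h0 m, hy⟩

theorem iterate_mono {H : SVMap n} (h0 : 0 ∈ H 0) {k m : ℕ} (hkm : k ≤ m) :
    (imSet H)^[k] {0} ⊆ (imSet H)^[m] {0} := by
  obtain ⟨j, rfl⟩ := Nat.exists_eq_add_of_le hkm
  exact iterate_le_iterate_add h0 k j

theorem mem_reach {H : SVMap n} {y : EuclideanSpace ℝ (Fin n)} :
    y ∈ reach H ↔ ∃ k, y ∈ (imSet H)^[k] {0} := by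
  simp [reach]

/-- The reachable set of a convex process, as a pointed cone. -/
def reachCone (H : SVMap n) (hH : IsConvexProcess H) :
    PointedCone ℝ (EuclideanSpace ℝ (Fin n)) where
  carrier := reach H
  zero_mem' := mem_reach.2 ⟨0, by simp⟩
  add_mem' := by
    intro a b ha hb
    obtain ⟨k, hk⟩ := mem_reach.1 ha
    obtain ⟨m, hm⟩ := mem_reach.1 hb
    refine mem_reach.2 ⟨max k m, ?_⟩
    have := iterate_add_mem (K := H) (fun _ _ _ _ => hH.add_mem)
      (iterate_mono hH.zero_mem (le_max_left k m) hk)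
      (iterate_mono hH.zero_mem (le_max_right k m) hm)
    simpa using this
  smul_mem' := by
    intro c x hx
    obtain ⟨k, hk⟩ := mem_reach.1 hx
    have := iterate_smul_mem (H := H) (c := (c : ℝ)) (fun _ _ => hH.smul_mem c.2) hk
    rw [smul_zero] at this
    exact mem_reach.2 ⟨k, this⟩

/-- The reachable set of a symmetric convex process is attained in finitely many steps. -/
theorem exists_iterate_eq_reach {L : SVMap n} (hL : IsConvexProcess L)
    (hneg : ∀ x y, y ∈ L x → -y ∈ L (-x)) : ∃ ℓ, reach L = (imSet L)^[ℓ] {0} := by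
  have hsmul : ∀ (c : ℝ) (x y : EuclideanSpace ℝ (Fin n)), y ∈ L x → c • y ∈ L (c • x) := by
    intro c x y h
    rcases le_total 0 c with hc | hc
    · exact hL.smul_mem hc h
    · simpa using hL.smul_mem (neg_nonneg.2 hc) (hneg _ _ h)
  let S : ℕ →o Submodule ℝ (EuclideanSpace ℝ (Fin n)) :=
    { toFun := fun k =>
        { carrier := (imSet L)^[k] {0}
          zero_mem' := zero_mem_iterate hL.zero_mem k
          add_mem' := fun ha hb => by
            simpa using iterate_add_mem (K := L) (fun _ _ _ _ => hL.add_mem) ha hb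
          smul_mem' := fun c x hx => by
            simpa only [smul_zero] using iterate_smul_mem (c := c) (hsmul c) hx }
      monotone' := fun k m hkm => iterate_mono hL.zero_mem hkm }
  obtain ⟨ℓ, hℓ⟩ := monotone_stabilizes_iff_noetherian.2 inferInstance S
  refine ⟨ℓ, subset_antisymm (fun y hy => ?_) (subset_iUnion (fun k => (imSet L)^[k] {0}) ℓ)⟩
  obtain ⟨k, hk⟩ := mem_reach.1 hy
  have h1 : y ∈ S (max ℓ k) := iterate_mono hL.zero_mem (le_max_right ℓ k) hk
  rw [← hℓ _ (le_max_left ℓ k)] at h1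
  exact h1

theorem neg_mem_reach {L : SVMap n} (hneg : ∀ x y, y ∈ L x → -y ∈ L (-x))
    {y : EuclideanSpace ℝ (Fin n)} (hy : y ∈ reach L) : -y ∈ reach L := by
  obtain ⟨k, hk⟩ := mem_reach.1 hy
  have := iterate_smul_mem (c := -1) (fun x y h => by simpa using hneg x y h) hk
  exact mem_reach.2 ⟨k, by simpa using this⟩

end Iterates

section Linear

variable {H : SVMap n}

theorem IsConvexProcess.inv (hH : IsConvexProcess H) : IsConvexProcess (invMap H) :=
  .of_add_smul hH.zero_mem (fun _ _ _ _ h h' => hH.add_mem h h')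
    (fun _ hc _ _ h => hH.smul_mem hc h)

theorem IsConvexProcess.lminus (hH : IsConvexProcess H) : IsConvexProcess (Lminus H) :=
  .of_add_smul ⟨hH.zero_mem, by simpa using hH.zero_mem⟩
    (fun x y x' y' h h' => ⟨hH.add_mem h.1 h'.1, by
      rw [neg_add, neg_add]; exact hH.add_mem h.2 h'.2⟩)
    (fun c hc x y h => ⟨hH.smul_mem hc h.1, by
      rw [← smul_neg, ← smul_neg]; exact hH.smul_mem hc h.2⟩)

theorem Lminus_neg (x y : EuclideanSpace ℝ (Fin n)) (h : y ∈ Lminus H x) :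
    -y ∈ Lminus H (-x) := ⟨h.2, by simpa using h.1⟩

theorem IsConvexProcess.lplus (hH : IsConvexProcess H) : IsConvexProcess (Lplus H) := by
  refine .of_add_smul ⟨0, 0, 0, 0, hH.zero_mem, hH.zero_mem, by simp, by simp⟩ ?_ ?_
  · rintro _ _ _ _ ⟨x₁, y₁, x₂, y₂, h₁, h₂, rfl, rfl⟩ ⟨x₃, y₃, x₄, y₄, h₃, h₄, rfl, rfl⟩
    exact ⟨_, _, _, _, hH.add_mem h₁ h₃, hH.add_mem h₂ h₄, by abel, by abel⟩
  · rintro c hc _ _ ⟨x₁, y₁, x₂, y₂, h₁, h₂, rfl, rfl⟩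
    exact ⟨_, _, _, _, hH.smul_mem hc h₁, hH.smul_mem hc h₂, smul_sub _ _ _, smul_sub _ _ _⟩

theorem Lplus_neg (x y : EuclideanSpace ℝ (Fin n)) (h : y ∈ Lplus H x) :
    -y ∈ Lplus H (-x) := by
  obtain ⟨x₁, y₁, x₂, y₂, h₁, h₂, rfl, rfl⟩ := h
  exact ⟨x₂, y₂, x₁, y₁, h₂, h₁, by abel, by abel⟩

theorem IsConvexProcess.add_lminus_mem (hH : IsConvexProcess H)
    (x y x' y' : EuclideanSpace ℝ (Fin n)) (h : y ∈ H x) (h' : y' ∈ Lminus H x') :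
    y + y' ∈ H (x + x') := hH.add_mem h h'.1

theorem exists_iterate_Lminus_eq (hH : IsConvexProcess H) (k : ℕ)
    {r : EuclideanSpace ℝ (Fin n)} (hr : r ∈ reach (Lminus H)) :
    ∃ s ∈ reach (Lminus H), r ∈ (imSet (Lminus H))^[k] {s} := by
  obtain ⟨j, hj⟩ := mem_reach.1 hr
  have h1 := iterate_le_iterate_add hH.lminus.zero_mem j k hj
  rw [add_comm, Function.iterate_add_apply] at h1
  obtain ⟨s, hs, hrs⟩ := mem_iterate_iff.1 h1
  exact ⟨s, mem_reach.2 ⟨j, hs⟩, hrs⟩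

theorem mem_nullc_of_iterate {k : ℕ} {x y : EuclideanSpace ℝ (Fin n)}
    (h : y ∈ (imSet H)^[k] {x}) (hy : y ∈ nullc H) : x ∈ nullc H := by
  induction k generalizing y with
  | zero => simp_all
  | succ k ih =>
    obtain ⟨w, hw, hyw⟩ := mem_iterate_succ.1 h
    obtain ⟨j, hj⟩ := mem_reach.1 hy
    exact ih hw (mem_reach.2 ⟨j + 1, mem_iterate_succ.2 ⟨y, hj, hyw⟩⟩)

theorem nullc_Lminus_subset : nullc (Lminus H) ⊆ nullc H :=
  reach_mono fun _ _ h => h.1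

theorem neg_mem_nullc_Lminus {x : EuclideanSpace ℝ (Fin n)} (h : x ∈ nullc (Lminus H)) :
    -x ∈ nullc (Lminus H) :=
  neg_mem_reach (L := invMap (Lminus H)) (fun x y h => Lminus_neg y x h) h

/-- If the domain of `H` is transverse to the reachable subspace of `L₋`, then so is the
feasible set. -/
theorem feas_add_reach_Lminus (hH : IsConvexProcess H)
    (hdom : dom H + reach (Lminus H) = Set.univ) : feas H + reach (Lminus H) = Set.univ := by
  have hD : ∀ z, ∃ r ∈ reach (Lminus H), z + r ∈ dom H := fun z => by
    obtain ⟨d, hd, r, hr, rfl⟩ := Set.mem_add.1 (hdom ▸ mem_univ z)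
    exact ⟨-r, neg_mem_reach Lminus_neg hr, by simpa using hd⟩
  obtain ⟨ℓ, hℓ⟩ := exists_iterate_eq_reach hH.lminus Lminus_neg
  have hstep : ∀ x, ((imSet H)^[ℓ] {x}).Nonempty →
      ∃ x' ∈ H x, ((imSet H)^[ℓ] {x'}).Nonempty := by
    rintro x ⟨y, hy⟩
    obtain ⟨r, hr, w, hw⟩ := hD y
    rw [hℓ] at hr
    have h1 := iterate_add_mem hH.add_lminus_mem hy hr
    rw [add_zero] at h1
    have h2 : w ∈ (imSet H)^[ℓ + 1] {x} := mem_iterate_succ.2 ⟨_, h1, hw⟩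
    rw [Function.iterate_succ_apply] at h2
    obtain ⟨x', hx', hw'⟩ := mem_iterate_iff.1 h2
    obtain ⟨x'', rfl, hx''⟩ := mem_imSet.1 hx'
    exact ⟨x', hx'', w, hw'⟩
  have hfeas : ∀ x, ((imSet H)^[ℓ] {x}).Nonempty → x ∈ feas H := by
    intro x hx
    let f : {x // ((imSet H)^[ℓ] {x}).Nonempty} → {x // ((imSet H)^[ℓ] {x}).Nonempty} :=
      fun x => ⟨(hstep x x.2).choose, (hstep x x.2).choose_spec.2⟩
    refine ⟨fun k => (f^[k] ⟨x, hx⟩).1, rfl, fun k => ?_⟩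
    simp only [Function.iterate_succ_apply']
    exact (hstep _ (f^[k] ⟨x, hx⟩).2).choose_spec.1
  have hall : ∀ k z, ∃ r ∈ reach (Lminus H), ((imSet H)^[k] {z + r}).Nonempty := by
    intro k z
    induction k with
    | zero => exact ⟨0, (reachCone _ hH.lminus).zero_mem, by simp⟩
    | succ k ih =>
      obtain ⟨r, hr, y, hy⟩ := ih
      obtain ⟨r', hr', w, hw⟩ := hD y
      obtain ⟨s, hs, hsr⟩ := exists_iterate_Lminus_eq hH k hr'
      have h1 := iterate_add_mem hH.add_lminus_mem hy hsr
      rw [add_assoc] at h1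
      exact ⟨r + s, (reachCone _ hH.lminus).add_mem hr hs, w, mem_iterate_succ.2 ⟨_, h1, hw⟩⟩
  refine eq_univ_of_forall fun z => ?_
  obtain ⟨r, hr, hne⟩ := hall ℓ z
  exact Set.mem_add.2 ⟨z + r, hfeas _ hne, -r, neg_mem_reach Lminus_neg hr, by simp⟩

theorem iterate_nonempty_of_mem_feas {x : EuclideanSpace ℝ (Fin n)} (hx : x ∈ feas H) (k : ℕ) :
    ((imSet H)^[k] {x}).Nonempty := by
  obtain ⟨u, rfl, hu⟩ := hx
  refine ⟨u k, ?_⟩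
  induction k with
  | zero => simp
  | succ k ih => exact mem_iterate_succ.2 ⟨_, ih, hu k⟩

/-- If every state is the sum of a null-controllable one and one reachable for `L₋`, then `H` is
null-controllable. -/
theorem isNullControllable_of_nullc_add_reach (hH : IsConvexProcess H)
    (h : ∀ z, ∃ c ∈ nullc H, ∃ r ∈ reach (Lminus H), c + r = z) : IsNullControllable H := by
  intro x hx
  obtain ⟨ℓ, hℓ⟩ := exists_iterate_eq_reach hH.lminus Lminus_neg
  obtain ⟨y, hy⟩ := iterate_nonempty_of_mem_feas hx ℓ
  obtain ⟨c, hc, r, hr, rfl⟩ := h y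
  have hr' := neg_mem_reach Lminus_neg hr
  rw [hℓ] at hr'
  have := iterate_add_mem hH.add_lminus_mem hy hr'
  rw [add_zero, add_neg_cancel_right] at this
  exact mem_nullc_of_iterate this hc

/-- An eigenvector of the negative dual with positive eigenvalue excludes
null-controllability. -/
theorem not_isNullControllable_of_eigenvector (hH : IsConvexProcess H)
    (hdom : dom H + reach (Lminus H) = Set.univ) {lam : ℝ} (hlam : 0 < lam)
    {ξ : EuclideanSpace ℝ (Fin n)} (hξ : ξ ≠ 0) (h : lam • ξ ∈ negDual H ξ) :
    ¬ IsNullControllable H := by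
  intro hnc
  have hle : ∀ x y, y ∈ H x → ⟪ξ, y⟫ ≤ lam * ⟪ξ, x⟫ := fun x y hy => by
    simpa [real_inner_smul_left] using h x y hy
  have hN : ∀ x ∈ nullc H, 0 ≤ ⟪ξ, x⟫ := by
    intro x hx
    obtain ⟨k, hk⟩ := mem_reach.1 hx
    induction k generalizing x with
    | zero => simp_all
    | succ k ih =>
      obtain ⟨y, hy, hyx⟩ := mem_iterate_succ.1 hk
      have h1 := ih y (mem_reach.2 ⟨k, hy⟩) hy
      exact nonneg_of_mul_nonneg_right (h1.trans (hle x y hyx)) hlam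
  have hR : ∀ r ∈ reach (Lminus H), ⟪ξ, r⟫ = 0 := by
    intro r hr
    obtain ⟨k, hk⟩ := mem_reach.1 hr
    clear hr
    induction k generalizing r with
    | zero => simp_all
    | succ k ih =>
      obtain ⟨x, hx, hxr⟩ := mem_iterate_succ.1 hk
      have h0 := ih x hx
      have h1 := hle _ _ hxr.1
      have h2 := hle _ _ hxr.2
      rw [inner_neg_right, inner_neg_right, h0] at h2
      rw [h0] at h1
      linarith
  have := feas_add_reach_Lminus hH hdom
  obtain ⟨x, hx, r, hr, hxr⟩ := Set.mem_add.1 (this ▸ mem_univ (-ξ))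
  have h1 := hN x (hnc hx)
  have h2 : ⟪ξ, x + r⟫ = ⟪ξ, -ξ⟫ := by rw [hxr]
  rw [inner_add_right, hR r hr, inner_neg_right] at h2
  have h3 := real_inner_self_pos.2 hξ
  linarith

end Linear

section Dual

variable {H : SVMap n}

/-- One step of the dual trajectory: a functional nonnegative on an `H⁻¹`-invariant cone `C`
can be pushed forward, staying nonnegative on `C`. -/
theorem exists_dual_step (hH : IsConvexProcess H) (C : PointedCone ℝ (EuclideanSpace ℝ (Fin n)))
    (hinv : ∀ x y, y ∈ H x → y ∈ C → x ∈ C)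
    (him : ∀ z, ∃ x y, y ∈ H x ∧ ∃ c ∈ C, z = y - c)
    {q : EuclideanSpace ℝ (Fin n)} (hq : ∀ c ∈ C, 0 ≤ ⟪q, c⟫) :
    ∃ p : EuclideanSpace ℝ (Fin n), (∀ c ∈ C, 0 ≤ ⟪p, c⟫) ∧
      ∀ x y, y ∈ H x → ⟪p, y⟫ ≤ ⟪q, x⟫ := by
  let S : PointedCone ℝ (EuclideanSpace ℝ (Fin n) × ℝ) :=
    { carrier := {w | ∃ x y, y ∈ H x ∧ ∃ c ∈ C, w.1 = y - c ∧ ⟪q, x⟫ ≤ w.2}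
      zero_mem' := ⟨0, 0, hH.zero_mem, 0, C.zero_mem, by simp, by simp⟩
      add_mem' := by
        rintro ⟨z, t⟩ ⟨z', t'⟩ ⟨x, y, hy, c, hc, h1, h2⟩ ⟨x', y', hy', c', hc', h1', h2'⟩
        refine ⟨x + x', y + y', hH.add_mem hy hy', c + c', C.add_mem hc hc', ?_, ?_⟩
        · simp only [Prod.mk_add_mk] at *
          rw [h1, h1']; abel
        · simp only [Prod.mk_add_mk, inner_add_right] at *
          linarith
      smul_mem' := by
        rintro a ⟨z, t⟩ ⟨x, y, hy, c, hc, h1, h2⟩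
        refine ⟨(a : ℝ) • x, (a : ℝ) • y, hH.smul_mem a.2 hy, a • c, C.smul_mem a.2 hc, ?_, ?_⟩
        · simp only at h1
          subst h1
          exact smul_sub (a : ℝ) y c
        · rw [real_inner_smul_right]
          exact mul_le_mul_of_nonneg_left h2 a.2 }
  let D : Submodule ℝ (EuclideanSpace ℝ (Fin n) × ℝ) :=
    LinearMap.ker (LinearMap.fst ℝ (EuclideanSpace ℝ (Fin n)) ℝ)
  obtain ⟨g, hgf, hgS⟩ := riesz_extension S
    ⟨D, (LinearMap.snd ℝ (EuclideanSpace ℝ (Fin n)) ℝ).comp D.subtype⟩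
    (by
      rintro ⟨⟨z, t⟩, hz⟩ ⟨x, y, hy, c, hc, h1, h2⟩
      obtain rfl : z = 0 := hz
      obtain rfl : y = c := (sub_eq_zero.1 h1.symm)
      exact (hq x (hinv x y hy hc)).trans h2)
    (by
      rintro ⟨z, t⟩
      obtain ⟨x, y, hy, c, hc, rfl⟩ := him z
      exact ⟨⟨(0, ⟪q, x⟫ - t), rfl⟩, x, y, hy, c, hc, by simp, by simp⟩)
  have hg1 : ∀ t : ℝ, g (0, t) = t := fun t => hgf ⟨(0, t), rfl⟩
  let φ : EuclideanSpace ℝ (Fin n) →ₗ[ℝ] ℝ := g.comp (LinearMap.inl ℝ _ ℝ)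
  set p := (InnerProductSpace.toDual ℝ (EuclideanSpace ℝ (Fin n))).symm
    (LinearMap.toContinuousLinearMap φ) with hp
  have hpφ : ∀ z, ⟪p, z⟫ = g (z, 0) := fun z => by
    rw [hp, InnerProductSpace.toDual_symm_apply]; rfl
  refine ⟨-p, fun c hc => ?_, fun x y hy => ?_⟩
  · have := hgS (-c, 0) ⟨0, 0, hH.zero_mem, c, hc, by simp, by simp⟩
    rw [← hpφ, inner_neg_right] at this
    rwa [inner_neg_left]
  · have := hgS (y, ⟪q, x⟫) ⟨x, y, hy, 0, C.zero_mem, by simp, le_rfl⟩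
    have hsplit : ((y, ⟪q, x⟫) : EuclideanSpace ℝ (Fin n) × ℝ) = (y, 0) + (0, ⟪q, x⟫) := by simp
    rw [hsplit, map_add, hg1, ← hpφ] at this
    rw [inner_neg_left]
    linarith

/-- A proper `H⁻¹`-invariant cone transverse to the domain and the image of `H` yields an
eigenvector of the negative dual with positive eigenvalue. -/
theorem exists_eigenvector_negDual (hH : IsConvexProcess H) (hRplus : reach (Lplus H) = Set.univ)
    (C : PointedCone ℝ (EuclideanSpace ℝ (Fin n)))
    (hinv : ∀ x y, y ∈ H x → y ∈ C → x ∈ C)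
    (him : ∀ z, ∃ x y, y ∈ H x ∧ ∃ c ∈ C, z = y - c)
    (hdom : ∀ z, ∃ x y, y ∈ H x ∧ ∃ c ∈ C, z = x + c)
    {z : EuclideanSpace ℝ (Fin n)} (hz : z ∉ C) :
    ∃ lam : ℝ, 0 < lam ∧ ∃ ξ : EuclideanSpace ℝ (Fin n), ξ ≠ 0 ∧ lam • ξ ∈ negDual H ξ := by
  let T : PointedCone ℝ (EuclideanSpace ℝ (Fin n) × EuclideanSpace ℝ (Fin n)) :=
    { carrier := {w | (∀ c ∈ C, 0 ≤ ⟪w.1, c⟫) ∧ (∀ c ∈ C, 0 ≤ ⟪w.2, c⟫) ∧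
        ∀ x y, y ∈ H x → ⟪w.2, y⟫ ≤ ⟪w.1, x⟫}
      zero_mem' := by simp
      add_mem' := by
        rintro a b ⟨h1, h2, h3⟩ ⟨h1', h2', h3'⟩
        refine ⟨fun c hc => ?_, fun c hc => ?_, fun x y hy => ?_⟩ <;>
          simp only [Prod.fst_add, Prod.snd_add, inner_add_left]
        · exact add_nonneg (h1 c hc) (h1' c hc)
        · exact add_nonneg (h2 c hc) (h2' c hc)
        · exact add_le_add (h3 x y hy) (h3' x y hy)
      smul_mem' := by
        rintro a w ⟨h1, h2, h3⟩
        have e1 : ∀ v, ⟪(a • w).1, v⟫ = (a : ℝ) * ⟪w.1, v⟫ := fun v =>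
          real_inner_smul_left w.1 v (a : ℝ)
        have e2 : ∀ v, ⟪(a • w).2, v⟫ = (a : ℝ) * ⟪w.2, v⟫ := fun v =>
          real_inner_smul_left w.2 v (a : ℝ)
        refine ⟨fun c hc => ?_, fun c hc => ?_, fun x y hy => ?_⟩
        · rw [e1]; exact mul_nonneg a.2 (h1 c hc)
        · rw [e2]; exact mul_nonneg a.2 (h2 c hc)
        · rw [e1, e2]; exact mul_le_mul_of_nonneg_left (h3 x y hy) a.2 }
  have hTclosed : IsClosed (T : Set (EuclideanSpace ℝ (Fin n) × EuclideanSpace ℝ (Fin n))) := by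
    have : (T : Set (EuclideanSpace ℝ (Fin n) × EuclideanSpace ℝ (Fin n))) =
        {w | (∀ c ∈ C, 0 ≤ ⟪w.1, c⟫) ∧ (∀ c ∈ C, 0 ≤ ⟪w.2, c⟫) ∧
          ∀ x y, y ∈ H x → ⟪w.2, y⟫ ≤ ⟪w.1, x⟫} := rfl
    rw [this]
    simp only [ofPred_and, ofPred_forall]
    refine .inter ?_ (.inter ?_ ?_)
    · exact isClosed_biInter fun c _ => isClosed_le (by fun_prop) (by fun_prop)
    · exact isClosed_biInter fun c _ => isClosed_le (by fun_prop) (by fun_prop)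
    · exact isClosed_iInter fun x => isClosed_iInter fun y => isClosed_iInter fun _ =>
        isClosed_le (by fun_prop) (by fun_prop)
  have hfst : ∀ p, (0, p) ∈ T → p = 0 := by
    rintro p ⟨-, h2, h3⟩
    obtain ⟨x, y, hy, c, hc, hp⟩ := him p
    have e1 := h2 c hc
    have e2 := h3 x y hy
    have e3 : ⟪p, p⟫ = ⟪p, y⟫ - ⟪p, c⟫ := by rw [← inner_sub_right, ← hp]
    simp only [inner_zero_left] at e2
    exact inner_self_eq_zero (𝕜 := ℝ).1 (le_antisymm (by linarith) real_inner_self_nonneg)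
  have hsnd : ∀ q, (q, 0) ∈ T → q = 0 := by
    rintro q ⟨h1, -, h3⟩
    obtain ⟨x, y, hy, c, hc, hq⟩ := hdom (-q)
    have e1 := h1 c hc
    have e2 := h3 x y hy
    have e3 : ⟪q, -q⟫ = ⟪q, x⟫ + ⟪q, c⟫ := by rw [← inner_add_right, ← hq]
    rw [inner_neg_right] at e3
    simp only [inner_zero_left] at e2
    exact inner_self_eq_zero (𝕜 := ℝ).1 (le_antisymm (by linarith) real_inner_self_nonneg)
  have hstep : ∀ q : EuclideanSpace ℝ (Fin n), (∀ c ∈ C, 0 ≤ ⟪q, c⟫) → ∃ p, (q, p) ∈ T :=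
    fun q hq => by
      obtain ⟨p, hp, hpq⟩ := exists_dual_step hH C hinv him hq
      exact ⟨p, hq, hp, hpq⟩
  have hlin : ∀ q : EuclideanSpace ℝ (Fin n), (∀ c ∈ C, ⟪q, c⟫ = 0) →
      ∃ p, (q, p) ∈ T ∧ (∀ c ∈ C, ⟪p, c⟫ = 0) ∧ ∀ x y, y ∈ Lplus H x → ⟪p, y⟫ = ⟪q, x⟫ := by
    intro q hq
    obtain ⟨p, hp⟩ := hstep q fun c hc => (hq c hc).ge
    obtain ⟨p', hp'⟩ := hstep (-q) fun c hc => by rw [inner_neg_left, hq c hc, neg_zero]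
    have hsum := T.add_mem hp hp'
    rw [Prod.mk_add_mk, add_neg_cancel] at hsum
    obtain rfl : p' = -p := (neg_eq_of_add_eq_zero_right (hfst _ hsum)).symm
    have hgr : ∀ x y, y ∈ H x → ⟪p, y⟫ = ⟪q, x⟫ := fun x y hy => by
      have e1 := hp.2.2 x y hy
      have e2 := hp'.2.2 x y hy
      simp only [inner_neg_left] at e1 e2
      linarith
    refine ⟨p, hp, fun c hc => ?_, ?_⟩
    · have e1 := hp.2.1 c hc
      have e2 := hp'.2.1 c hc
      simp only [inner_neg_left] at e1 e2
      linarith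
    · rintro _ _ ⟨x₁, y₁, x₂, y₂, h₁, h₂, rfl, rfl⟩
      rw [inner_sub_right, inner_sub_right, hgr _ _ h₁, hgr _ _ h₂]
  have hsalient : ∀ q : EuclideanSpace ℝ (Fin n), (∀ c ∈ C, ⟪q, c⟫ = 0) → q = 0 := by
    intro q hq
    obtain ⟨ℓ, hℓ⟩ := exists_iterate_eq_reach hH.lplus Lplus_neg
    rw [hRplus] at hℓ
    have key : ∀ k, ∃ p : EuclideanSpace ℝ (Fin n), (∀ c ∈ C, ⟪p, c⟫ = 0) ∧
        (∀ y ∈ (imSet (Lplus H))^[k] {0}, ⟪p, y⟫ = 0) ∧ (p = 0 → q = 0) := by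
      intro k
      induction k with
      | zero => exact ⟨q, hq, by simp, id⟩
      | succ k ih =>
        obtain ⟨p, hpC, hpR, hpq⟩ := ih
        obtain ⟨p', hT, hp'C, hp'L⟩ := hlin p hpC
        refine ⟨p', hp'C, fun y hy => ?_, fun h0 => hpq (hsnd p (h0 ▸ hT))⟩
        obtain ⟨x, hx, hxy⟩ := mem_iterate_succ.1 hy
        rw [hp'L x y hxy, hpR x hx]
    obtain ⟨p, -, hp, hpq⟩ := key ℓ
    exact hpq (inner_self_eq_zero (𝕜 := ℝ).1 (hp p (hℓ ▸ mem_univ p)))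
  obtain ⟨e, he⟩ := interior_nonempty_of_forall_inner_eq_zero C hsalient
  obtain ⟨δ, hδ, hball⟩ := Metric.nhds_basis_closedBall.mem_iff.1 (mem_interior_iff_mem_nhds.1 he)
  have hbound : ∀ q : EuclideanSpace ℝ (Fin n), (∀ c ∈ C, 0 ≤ ⟪q, c⟫) → δ * ‖q‖ ≤ ⟪e, q⟫ := by
    intro q hq
    rcases eq_or_ne q 0 with rfl | hq0
    · simp
    have hn : 0 < ‖q‖ := norm_pos_iff.2 hq0
    have hmem : e - (δ / ‖q‖) • q ∈ C := hball (by
      rw [Metric.mem_closedBall, dist_eq_norm, sub_sub_cancel_left, norm_neg, norm_smul,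
        Real.norm_of_nonneg (by positivity), div_mul_cancel₀ _ hn.ne'])
    have := hq _ hmem
    rw [inner_sub_right, real_inner_smul_right, real_inner_self_eq_norm_sq, real_inner_comm] at this
    have h2 : δ / ‖q‖ * ‖q‖ ^ 2 = δ * ‖q‖ := by field_simp
    linarith
  obtain ⟨q₀, hq₀, hq₀C⟩ := exists_ne_zero_forall_inner_nonneg C hz
  let f : {q : EuclideanSpace ℝ (Fin n) // ∀ c ∈ C, 0 ≤ ⟪q, c⟫} →
      {q : EuclideanSpace ℝ (Fin n) // ∀ c ∈ C, 0 ≤ ⟪q, c⟫} :=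
    fun q => ⟨(hstep q q.2).choose, (hstep q q.2).choose_spec.2.1⟩
  obtain ⟨s, hs, ξ, hξ, hT⟩ := exists_eigenvector_of_trajectory T hTclosed hfst hsnd
    (fun k => (f^[k] ⟨q₀, hq₀C⟩).1)
    (fun k => by
      simp only [Function.iterate_succ_apply']
      exact (hstep _ (f^[k] ⟨q₀, hq₀C⟩).2).choose_spec)
    hq₀ e δ hδ (fun k => hbound _ (f^[k] ⟨q₀, hq₀C⟩).2)
  refine ⟨s⁻¹, inv_pos.2 hs, ξ, hξ, fun x y hy => ?_⟩
  have := hT.2.2 x y hy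
  simp only [real_inner_smul_left] at this ⊢
  rwa [inv_mul_eq_div, le_div_iff₀ hs, mul_comm]

end Dual

/-- null-controllability iff H⁻ has no positive eigenvalues. -/
theorem nullcontrollability_iff {n : ℕ} (H : SVMap n) (hH : IsConvexProcess H)
    (hdom : dom H + reach (Lminus H) = Set.univ)
    (hRplus : reach (Lplus H) = Set.univ)
    (him : im H + nullc (Lminus H) = Set.univ) :
    IsNullControllable H ↔
      ¬ ∃ lam : ℝ, 0 < lam ∧ ∃ ξ : EuclideanSpace ℝ (Fin n), ξ ≠ 0 ∧ lam • ξ ∈ negDual H ξ := by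
  constructor
  · rintro hnc ⟨lam, hlam, ξ, hξ, h⟩
    exact not_isNullControllable_of_eigenvector hH hdom hlam hξ h hnc
  · intro hno
    refine isNullControllable_of_nullc_add_reach hH ?_
    by_contra! hz
    obtain ⟨z, hz⟩ := hz
    refine hno (exists_eigenvector_negDual hH hRplus
      (reachCone _ hH.inv ⊔ reachCone _ hH.lminus) ?_ ?_ ?_ (z := z) ?_)
    · intro x y hy hyC
      obtain ⟨c, hc, r, hr, rfl⟩ := Submodule.mem_sup.1 hyC
      obtain ⟨s, hs, hsr⟩ := exists_iterate_Lminus_eq hH 1 hr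
      obtain ⟨w, rfl, hwr⟩ := mem_imSet.1 hsr
      have h1 := hH.add_lminus_mem _ _ _ _ hy (Lminus_neg _ _ hwr)
      rw [add_neg_cancel_right] at h1
      obtain ⟨k, hk⟩ := mem_reach.1 hc
      exact Submodule.mem_sup.2 ⟨x + -w, mem_reach.2 ⟨k + 1, mem_iterate_succ.2 ⟨c, hk, h1⟩⟩,
        w, hs, by abel⟩
    · intro z
      obtain ⟨y, ⟨x, hy⟩, c, hc, rfl⟩ := Set.mem_add.1 (him ▸ mem_univ z)
      exact ⟨x, y, hy, -c, Submodule.mem_sup_left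
        (nullc_Lminus_subset (neg_mem_nullc_Lminus hc)), by abel⟩
    · intro z
      obtain ⟨x, ⟨y, hy⟩, r, hr, rfl⟩ := Set.mem_add.1 (hdom ▸ mem_univ z)
      exact ⟨x, y, hy, r, Submodule.mem_sup_right hr, rfl⟩
    · intro hzC
      obtain ⟨c, hc, r, hr, hcr⟩ := Submodule.mem_sup.1 hzC
      exact hz c hc r hr hcr

end ConvexProcessPaper
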